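/- arXiv:2208.05783 — 5 statements merged into one kernel-verified Lean document; each statement's English description precedes it below -/
import Mathlib

section
/- Let (Φ, Ψ) be a solution on an interval I ⊆ ℝ of the linear matrix system Φ' = R(t)Φ + P(t)Ψ, Ψ' = S(t)Φ − Q(t)Ψ, and suppose Φ(t) is invertible for every t ∈ I. Then Y(t) := Ψ(t)Φ(t)⁻¹ is differentiable on I and is a solution of the matrix Riccati equation Y' + Y P(t) Y + Q(t) Y + Y R(t) − S(t) = 0 on I. -/
open Matrix

theorem HasDerivWithinAt.ringInverse_of_isUnit {𝕜 A : Type*} [NontriviallyNormedField 𝕜]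
    [NormedRing A] [HasSummableGeomSeries A] [NormedAlgebra 𝕜 A] {f : 𝕜 → A} {f' : A}
    {s : Set 𝕜} {t : 𝕜} (hf : HasDerivWithinAt f f' s t) (hu : IsUnit (f t)) :
    HasDerivWithinAt (fun x => Ring.inverse (f x))
      (-(Ring.inverse (f t) * f' * Ring.inverse (f t))) s t := by
  obtain ⟨u, hu⟩ := hu
  have h := hasFDerivAt_ringInverse (𝕜 := 𝕜) u
  rw [hu] at h
  simpa [← hu, Function.comp_def] using h.comp_hasDerivWithinAt t hf

section LinftyOp

attribute [local instance] Matrix.linftyOpNormedRing Matrix.linftyOpNormedAlgebra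

theorem Matrix.hasDerivWithinAt_mul_nonsing_inv {m : Type*} [Fintype m] [DecidableEq m]
    {Φ Ψ : ℝ → Matrix m m ℂ} {Φ' Ψ' : Matrix m m ℂ} {s : Set ℝ} {t : ℝ}
    (hΦ : HasDerivWithinAt Φ Φ' s t) (hΨ : HasDerivWithinAt Ψ Ψ' s t) (hu : IsUnit (Φ t)) :
    HasDerivWithinAt (fun x => Ψ x * (Φ x)⁻¹)
      (Ψ' * (Φ t)⁻¹ - Ψ t * (Φ t)⁻¹ * Φ' * (Φ t)⁻¹) s t := by
  simp only [Matrix.nonsing_inv_eq_ringInverse]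
  refine (hΨ.mul (hΦ.ringInverse_of_isUnit hu)).congr_deriv ?_
  noncomm_ring

end LinftyOp

attribute [local instance] Matrix.normedAddCommGroup Matrix.normedSpace

theorem linear_system_to_riccati {n : ℕ}
    (P Q R S : ℝ → Matrix (Fin n) (Fin n) ℂ)
    (hP : Continuous P) (hQ : Continuous Q) (hR : Continuous R) (hS : Continuous S)
    (I : Set ℝ)
    (Φ Ψ : ℝ → Matrix (Fin n) (Fin n) ℂ)
    (hΦ : ∀ t ∈ I, HasDerivWithinAt Φ (R t * Φ t + P t * Ψ t) I t)
    (hΨ : ∀ t ∈ I, HasDerivWithinAt Ψ (S t * Φ t - Q t * Ψ t) I t)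
    (hinv : ∀ t ∈ I, IsUnit (Φ t))
    (Y : ℝ → Matrix (Fin n) (Fin n) ℂ)
    (hY : Y = fun t => Ψ t * (Φ t)⁻¹) :
    ∀ t ∈ I, HasDerivWithinAt Y
      (S t - Y t * P t * Y t - Q t * Y t - Y t * R t) I t := by
  intro t ht
  subst hY
  have hdet := (Matrix.isUnit_iff_isUnit_det _).mp (hinv t ht)
  convert Matrix.hasDerivWithinAt_mul_nonsing_inv (hΦ t ht) (hΨ t ht) (hinv t ht) using 1
  simp only [sub_mul, mul_add, add_mul, Matrix.mul_assoc, Matrix.mul_nonsing_inv _ hdet,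
    Matrix.mul_one]
  abel
end

section
/- (Liouville's formula) Let A : ℝ → Matrix (Fin n) (Fin n) ℂ be continuous and let Φ : ℝ → Matrix (Fin n) (Fin n) ℂ be differentiable with Φ'(t) = A(t)Φ(t) for all t in an interval [t₀, t₁). Then for every t ∈ [t₀, t₁), det Φ(t) = det Φ(t₀) · exp(∫_{t₀}^{t} tr A(τ) dτ). -/
open Matrix

attribute [local instance] Matrix.normedAddCommGroup Matrix.normedSpace

/-- **Jacobi's formula**: the derivative of the determinant of a matrix whose entries are
differentiable within a set. -/
theorem hasDerivWithinAt_det {𝕜 R m : Type*} [NontriviallyNormedField 𝕜] [NormedCommRing R]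
    [NormedAlgebra 𝕜 R] [Fintype m] [DecidableEq m] {M : 𝕜 → Matrix m m R} {M' : Matrix m m R}
    {s : Set 𝕜} {x : 𝕜} (hM : ∀ i j, HasDerivWithinAt (fun t ↦ M t i j) (M' i j) s x) :
    HasDerivWithinAt (fun t ↦ (M t).det) (((M x).adjugate * M').trace) s x := by
  have hderiv : HasDerivWithinAt (fun t ↦ (M t).det)
      (∑ σ : Equiv.Perm m, ((Equiv.Perm.sign σ : ℤ) : R) *
        ∑ i, (∏ j ∈ Finset.univ.erase i, M x (σ j) j) • M' (σ i) i) s x := by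
    simp only [det_apply']
    exact HasDerivWithinAt.fun_sum fun σ _ ↦
      (HasDerivWithinAt.fun_finsetProd fun i _ ↦ hM (σ i) i).const_mul _
  have hcol (i : m) : ((M x).adjugate * M') i i =
      ((M x).updateCol i fun k ↦ M' k i).det := by
    rw [← cramer_apply, cramer_eq_adjugate_mulVec]
    rfl
  convert hderiv using 1
  simp only [trace, diag_apply, hcol, det_apply', Finset.mul_sum]
  rw [Finset.sum_comm]
  refine Finset.sum_congr rfl fun σ _ ↦ Finset.sum_congr rfl fun i _ ↦ ?_
  rw [← Finset.prod_erase_mul _ _ (Finset.mem_univ i), updateCol_self, smul_eq_mul]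
  congr 2
  exact Finset.prod_congr rfl fun j hj ↦ updateCol_ne (Finset.ne_of_mem_erase hj)

/-- A solution of a scalar homogeneous linear equation on a convex set of reals, with continuous
coefficient `a`, is determined by its value at one point. -/
theorem eq_mul_exp_integral_of_hasDerivWithinAt {a y : ℝ → ℂ} (ha : Continuous a) {s : Set ℝ}
    (hs : Convex ℝ s) (hy : ∀ t ∈ s, HasDerivWithinAt y (a t * y t) s t) {t₀ t : ℝ}
    (ht₀ : t₀ ∈ s) (ht : t ∈ s) :
    y t = y t₀ * Complex.exp (∫ τ in t₀..t, a τ) := by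
  have hconst : ∀ u ∈ s,
      HasDerivWithinAt (fun v ↦ y v * Complex.exp (-∫ τ in t₀..v, a τ)) 0 s u := by
    intro u hu
    have hint : HasDerivAt (fun v ↦ ∫ τ in t₀..v, a τ) (a u) u :=
      ha.integral_hasStrictDerivAt t₀ u |>.hasDerivAt
    exact ((hy u hu).fun_mul hint.fun_neg.cexp.hasDerivWithinAt).congr_deriv (by ring)
  have h := hs.norm_image_sub_le_of_norm_hasDerivWithin_le (C := 0) hconst (by simp) ht₀ ht
  rw [zero_mul, norm_le_zero_iff, sub_eq_zero, intervalIntegral.integral_same, neg_zero,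
    Complex.exp_zero, mul_one] at h
  rw [← h, mul_assoc, ← Complex.exp_add, neg_add_cancel, Complex.exp_zero, mul_one]

theorem liouville_formula {n : ℕ}
    (A : ℝ → Matrix (Fin n) (Fin n) ℂ) (hA : Continuous A)
    (t₀ t₁ : ℝ)
    (Φ : ℝ → Matrix (Fin n) (Fin n) ℂ)
    (hΦ : ∀ t ∈ Set.Ico t₀ t₁,
      HasDerivWithinAt Φ (A t * Φ t) (Set.Ico t₀ t₁) t) :
    ∀ t ∈ Set.Ico t₀ t₁,
      (Φ t).det = (Φ t₀).det * Complex.exp (∫ τ in t₀..t, (A τ).trace) := by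
  intro t ht
  refine eq_mul_exp_integral_of_hasDerivWithinAt (s := Set.Ico t₀ t₁) (y := fun u ↦ (Φ u).det)
    hA.matrix_trace (convex_Ico t₀ t₁) (fun u hu ↦ ?_) ⟨le_rfl, ht.1.trans_lt ht.2⟩ ht
  refine (hasDerivWithinAt_det fun i j ↦
    hasDerivWithinAt_pi.1 (hasDerivWithinAt_pi.1 (hΦ u hu) i) j).congr_deriv ?_
  rw [trace_mul_comm, Matrix.mul_assoc, mul_adjugate, Matrix.mul_smul, mul_one, trace_smul,
    smul_eq_mul, mul_comm]
end

section
/- Let P, Q, R, S : ℝ → Matrix (Fin n) (Fin n) ℂ be continuous with P(t) Hermitian positive semidefinite for all t ≥ t₀. Let Y be a solution of Y' + Y P(t) Y + Q(t) Y + Y R(t) − S(t) = 0 on [t₀, t₁) with t₁ < ∞, and suppose there is a continuous function B : ℝ → Matrix (Fin n) (Fin n) ℂ with B(t) Hermitian such that Y(t) + Y(t)ᴴ − B(t) is positive semidefinite for all t ∈ [t₀, t₁). Then there exist ε > 0 and a solution Ỹ of the same equation on [t₀, t₁ + ε) with Ỹ(t) = Y(t) for all t ∈ [t₀, t₁); in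 particular [t₀, t₁) is not the maximum existence interval of Y. -/
open Matrix
open scoped ComplexOrder

attribute [local instance] Matrix.normedAddCommGroup Matrix.normedSpace

/-- Solutions of a linear differential equation exist near a given time `τ`, on an interval whose
length does not depend on the initial data. -/
theorem exists_forall_hasDerivAt_linear {E : Type*} [NormedAddCommGroup E] [NormedSpace ℝ E]
    [CompleteSpace E] {A : ℝ → E →L[ℝ] E} (hA : Continuous A) (τ : ℝ) :
    ∃ δ > 0, ∀ s ∈ Set.Ioo (τ - δ) (τ + δ), ∀ x : E, ∃ w : ℝ → E, w s = x ∧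
      ∀ t ∈ Set.Ioo (τ - δ) (τ + δ), HasDerivAt w (A t (w t)) t := by
  obtain ⟨K, hK⟩ := (isCompact_Icc (a := τ - 1) (b := τ + 1)).exists_bound_of_continuousOn
    hA.continuousOn
  have hK0 : 0 ≤ K := (norm_nonneg _).trans (hK τ (by constructor <;> linarith))
  have hpos : 0 < 4 * (K + 1) := by linarith
  set δ : ℝ := 1 / (4 * (K + 1)) with hδ
  have hδ0 : 0 < δ := by positivity
  have hKδ : 4 * (K + 1) * δ = 1 := by rw [hδ]; field_simp
  have hδ1 : δ ≤ 1 := by nlinarith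
  refine ⟨δ, hδ0, fun s hs x ↦ ?_⟩
  have hK' : ∀ t ∈ Set.Icc (τ - δ) (τ + δ), ‖A t‖ ≤ K := fun t ht ↦
    hK t ⟨by linarith [ht.1], by linarith [ht.2]⟩
  have hPL : IsPicardLindelof (fun t y ↦ A t y) (tmin := τ - δ) (tmax := τ + δ)
      ⟨s, hs.1.le, hs.2.le⟩ x ⟨‖x‖ + 1, by positivity⟩ 0
      ⟨K * (2 * ‖x‖ + 1), by positivity⟩ ⟨K, hK0⟩ := by
    refine ⟨fun t ht ↦ ?_, fun y _ ↦ ?_, fun t ht y hy ↦ ?_, ?_⟩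
    · exact ((A t).lipschitz.weaken (hK' t ht)).lipschitzOnWith
    · exact (hA.clm_apply continuous_const).continuousOn
    · have hy' : ‖y‖ ≤ 2 * ‖x‖ + 1 := by
        have h1 : ‖y - x‖ ≤ ‖x‖ + 1 := by
          rw [← dist_eq_norm]; exact hy
        have h2 := norm_add_le (y - x) x
        rw [sub_add_cancel] at h2
        linarith
      exact (A t).le_of_opNorm_le_of_le (hK' t ht) hy'
    · have hmax : max (τ + δ - s) (s - (τ - δ)) ≤ 2 * δ :=
        max_le (by linarith [hs.1]) (by linarith [hs.2])
      change K * (2 * ‖x‖ + 1) * max (τ + δ - s) (s - (τ - δ)) ≤ ‖x‖ + 1 - 0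
      calc _ ≤ K * (2 * ‖x‖ + 1) * (2 * δ) := by gcongr
        _ = (2 * K * δ) * (2 * ‖x‖ + 1) := by ring
        _ ≤ (1 / 2) * (2 * ‖x‖ + 1) := by gcongr; nlinarith
        _ ≤ _ := by linarith
  obtain ⟨w, hw, hw'⟩ := hPL.exists_eq_forall_mem_Icc_hasDerivWithinAt₀
  exact ⟨w, hw, fun t ht ↦ (hw' t (Set.Ioo_subset_Icc_self ht)).hasDerivAt
    (Icc_mem_nhds ht.1 ht.2)⟩

namespace Matrix

variable {m : Type*} [Fintype m]

/-- Matrix multiplication as a continuous bilinear map over `ℝ`, on the underlying functions. -/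
noncomputable def mulCLM (m : Type*) [Fintype m] :
    (m → m → ℂ) →L[ℝ] (m → m → ℂ) →L[ℝ] (m → m → ℂ) :=
  LinearMap.toContinuousLinearMap
    ((LinearMap.toContinuousLinearMap (𝕜 := ℝ) (E := m → m → ℂ) (F' := m → m → ℂ)).toLinearMap
      ∘ₗ LinearMap.mk₂ ℝ (fun A B ↦ of.symm (of A * of B))
        (fun A B C ↦ Matrix.add_mul (of A) (of B) (of C))
        (fun c A B ↦ Matrix.smul_mul c (of A) (of B))
        (fun A B C ↦ Matrix.mul_add (of A) (of B) (of C))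
        (fun c A B ↦ Matrix.mul_smul (of A) c (of B)))

theorem hasDerivAt_mul {A B : ℝ → Matrix m m ℂ} {A' B' : Matrix m m ℂ} {t : ℝ}
    (hA : HasDerivAt A A' t) (hB : HasDerivAt B B' t) :
    HasDerivAt (fun s ↦ A s * B s) (A t * B' + A' * B t) t :=
  (mulCLM m).hasDerivAt_of_bilinear (𝕜 := ℝ) (fun _ ↦ hA) (fun _ ↦ hB)

theorem re_trace_mul_conjTranspose {A B : Matrix m m ℂ} (hA : A.IsHermitian) :
    (A * Bᴴ).trace.re = (A * B).trace.re := by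
  have h : A * Bᴴ = (B * A)ᴴ := by rw [conjTranspose_mul, hA.eq]
  rw [h, trace_conjTranspose, trace_mul_comm B]
  rfl

variable [DecidableEq m]

/-- **Jacobi's formula** for the derivative of the determinant. -/
theorem hasDerivAt_det {A : ℝ → Matrix m m ℂ} {A' : Matrix m m ℂ} {t : ℝ}
    (hA : HasDerivAt A A' t) :
    HasDerivAt (fun s ↦ (A s).det) ((A t).adjugate * A').trace t := by
  have hentry : ∀ i j, HasDerivAt (fun s ↦ A s i j) (A' i j) t := fun i j ↦
    hasDerivAt_pi.1 (hasDerivAt_pi.1 hA i) j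
  have hderiv : HasDerivAt (fun s ↦ ∑ σ : Equiv.Perm m, (Equiv.Perm.sign σ : ℤ) •
      ∏ i, A s (σ i) i) (∑ σ : Equiv.Perm m, (Equiv.Perm.sign σ : ℤ) •
      ∑ i, (∏ j ∈ Finset.univ.erase i, A t (σ j) j) • A' (σ i) i) t :=
    HasDerivAt.fun_sum fun σ _ ↦ (HasDerivAt.fun_finsetProd
      fun i _ ↦ hentry (σ i) i).const_smul (Equiv.Perm.sign σ : ℤ)
  have htrace : ((A t).adjugate * A').trace = ∑ i, ((A t).updateCol i (fun k ↦ A' k i)).det := by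
    refine Finset.sum_congr rfl fun i _ ↦ ?_
    rw [← cramer_apply, cramer_eq_adjugate_mulVec]
    rfl
  convert hderiv using 1
  · funext s
    rw [det_apply]
    rfl
  · rw [htrace]
    simp_rw [det_apply, Finset.smul_sum]
    rw [Finset.sum_comm]
    refine Finset.sum_congr rfl fun σ _ ↦ Finset.sum_congr rfl fun i _ ↦ ?_
    rw [← Finset.prod_erase_mul _ _ (Finset.mem_univ i), updateCol_self, smul_eq_mul]
    congr 2
    exact Finset.prod_congr rfl fun j hj ↦ updateCol_ne (Finset.ne_of_mem_erase hj)

theorem hasDerivAt_inv {A : ℝ → Matrix m m ℂ} {A' : Matrix m m ℂ} {t : ℝ}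
    (hA : HasDerivAt A A' t) (hdet : (A t).det ≠ 0) :
    HasDerivAt (fun s ↦ (A s)⁻¹) (-((A t)⁻¹ * A' * (A t)⁻¹)) t := by
  have hcont : ContinuousAt (fun s ↦ (A s)⁻¹) t := by
    refine ContinuousAt.comp (g := Inv.inv) (continuousAt_matrix_inv _ ?_) hA.continuousAt
    simpa [Ring.inverse_eq_inv'] using continuousAt_inv₀ hdet
  have hne : ∀ᶠ s in nhdsWithin t {t}ᶜ, (A s).det ≠ 0 :=
    nhdsWithin_le_nhds ((hasDerivAt_det hA).continuousAt.eventually_ne hdet)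
  refine hasDerivAt_iff_tendsto_slope.2 ?_
  have hslope : Filter.Tendsto (slope A t) (nhdsWithin t {t}ᶜ) (nhds A') :=
    hasDerivAt_iff_tendsto_slope.1 hA
  have hlim : Filter.Tendsto (fun s ↦ -((A s)⁻¹ * slope A t s * (A t)⁻¹))
      (nhdsWithin t {t}ᶜ) (nhds (-((A t)⁻¹ * A' * (A t)⁻¹))) :=
    ((((hcont.tendsto.mono_left nhdsWithin_le_nhds).mul hslope)).mul tendsto_const_nhds).neg
  refine hlim.congr' ?_
  filter_upwards [hne] with s hs
  have h1 : (A s)⁻¹ * A s = 1 := nonsing_inv_mul _ (isUnit_iff_ne_zero.2 hs)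
  have h2 : A t * (A t)⁻¹ = 1 := mul_nonsing_inv _ (isUnit_iff_ne_zero.2 hdet)
  rw [slope_def_module, slope_def_module, mul_smul_comm, smul_mul_assoc, ← smul_neg, mul_sub,
    sub_mul, h1, Matrix.mul_assoc _ (A t), h2]
  simp

open scoped MatrixOrder in
/-- The trace of a product of two positive semidefinite matrices has nonnegative real part. -/
theorem PosSemidef.re_trace_mul_nonneg {A B : Matrix m m ℂ} (hA : A.PosSemidef)
    (hB : B.PosSemidef) : 0 ≤ (A * B).trace.re := by
  obtain ⟨D, rfl⟩ := CStarAlgebra.nonneg_iff_eq_star_mul_self.1 hA.nonneg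
  rw [Matrix.mul_assoc, trace_mul_comm]
  exact (Complex.le_def.1 (hB.mul_mul_conjTranspose_same D).trace_nonneg).1

/-- If `U` solves `U' = M U` and `re (tr M)` is bounded below, then `U` stays invertible, up to and
including the right end of the interval. -/
theorem det_ne_zero_of_hasDerivAt_mul {U M : ℝ → Matrix m m ℂ} {a b C : ℝ}
    (hU : ContinuousOn U (Set.Icc a b))
    (hderiv : ∀ t ∈ Set.Ioo a b, HasDerivAt U (M t * U t) t)
    (htrace : ∀ t ∈ Set.Ioo a b, -C ≤ (M t).trace.re) (ha : (U a).det ≠ 0) :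
    ∀ t ∈ Set.Icc a b, (U t).det ≠ 0 := by
  have hdet : ∀ t ∈ Set.Ioo a b,
      HasDerivAt (fun s ↦ (U s).det) ((U t).det * (M t).trace) t := by
    intro t ht
    refine (hasDerivAt_det (hderiv t ht)).congr_deriv ?_
    rw [trace_mul_comm, Matrix.mul_assoc, mul_adjugate, mul_smul_comm, Matrix.mul_one, trace_smul,
      smul_eq_mul]
  have hg : ∀ t ∈ Set.Ioo a b,
      HasDerivAt (fun s ↦ ‖(U s).det‖ ^ 2 * Real.exp (2 * C * s))
        (2 * (‖(U t).det‖ ^ 2 * Real.exp (2 * C * t) * ((M t).trace.re + C))) t := by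
    intro t ht
    have hexp : HasDerivAt (fun s ↦ Real.exp (2 * C * s)) (Real.exp (2 * C * t) * (2 * C)) t := by
      simpa using ((hasDerivAt_id t).const_mul (2 * C)).exp
    refine ((hdet t ht).norm_sq.mul hexp).congr_deriv ?_
    have hinner : inner ℝ (U t).det ((U t).det * (M t).trace)
        = ‖(U t).det‖ ^ 2 * (M t).trace.re := by
      rw [Complex.inner, ← Complex.normSq_eq_norm_sq, ← Complex.re_ofReal_mul,
        Complex.normSq_eq_conj_mul_self, mul_assoc]
      congr 1
      ring
    rw [hinner]
    ring
  have hmono : MonotoneOn (fun s ↦ ‖(U s).det‖ ^ 2 * Real.exp (2 * C * s)) (Set.Icc a b) := by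
    refine monotoneOn_of_deriv_nonneg (convex_Icc a b) ?_ ?_ ?_
    · have hc : ContinuousOn (fun s ↦ (U s).det) (Set.Icc a b) :=
        (continuous_id.matrix_det).comp_continuousOn hU
      fun_prop
    · rw [interior_Icc]
      exact fun t ht ↦ (hg t ht).differentiableAt.differentiableWithinAt
    · rw [interior_Icc]
      intro t ht
      rw [(hg t ht).deriv]
      have := htrace t ht
      have : 0 ≤ (M t).trace.re + C := by linarith
      positivity
  intro t ht h0
  have hle := hmono (Set.left_mem_Icc.2 (ht.1.trans ht.2)) ht ht.1
  simp only [h0, norm_zero] at hle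
  have : 0 < ‖(U a).det‖ ^ 2 * Real.exp (2 * C * a) := by positivity
  norm_num at hle
  linarith

end Matrix

section Riccati

variable {m : Type*} [Fintype m]

/-- The linear Hamiltonian system `U' = R U + P V`, `V' = S U - Q V` has solutions near every
time `τ`, on an interval whose length does not depend on the initial data. -/
theorem exists_forall_hasDerivAt_hamiltonian {P Q R S : ℝ → Matrix m m ℂ}
    (hP : Continuous P) (hQ : Continuous Q) (hR : Continuous R) (hS : Continuous S) (τ : ℝ) :
    ∃ δ > 0, ∀ s ∈ Set.Ioo (τ - δ) (τ + δ), ∀ U₀ V₀ : Matrix m m ℂ,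
      ∃ U V : ℝ → Matrix m m ℂ, U s = U₀ ∧ V s = V₀ ∧ ∀ t ∈ Set.Ioo (τ - δ) (τ + δ),
        HasDerivAt U (R t * U t + P t * V t) t ∧ HasDerivAt V (S t * U t - Q t * V t) t := by
  let X := m → m → ℂ
  have hmul : ∀ {F : ℝ → X}, Continuous F → Continuous fun t ↦ mulCLM m (F t) := fun hF ↦
    (mulCLM m).continuous.comp hF
  let A : ℝ → (X × X) →L[ℝ] (X × X) := fun t ↦
    (ContinuousLinearMap.inl ℝ X X).comp
        ((mulCLM m (R t)).comp (ContinuousLinearMap.fst ℝ X X)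
          + (mulCLM m (P t)).comp (ContinuousLinearMap.snd ℝ X X))
      + (ContinuousLinearMap.inr ℝ X X).comp
        ((mulCLM m (S t)).comp (ContinuousLinearMap.fst ℝ X X)
          - (mulCLM m (Q t)).comp (ContinuousLinearMap.snd ℝ X X))
  have hA : Continuous A :=
    (continuous_const.clm_comp (((hmul hR).clm_comp continuous_const).add
      ((hmul hP).clm_comp continuous_const))).add
    (continuous_const.clm_comp (((hmul hS).clm_comp continuous_const).sub
      ((hmul hQ).clm_comp continuous_const)))
  have hAapply : ∀ t x, A t x =
      (mulCLM m (R t) x.1 + mulCLM m (P t) x.2, mulCLM m (S t) x.1 - mulCLM m (Q t) x.2) := by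
    intro t x
    simp [A, X]
  have : CompleteSpace (X × X) := FiniteDimensional.complete ℝ (X × X)
  obtain ⟨δ, hδ, h⟩ := exists_forall_hasDerivAt_linear hA τ
  refine ⟨δ, hδ, fun s hs U₀ V₀ ↦ ?_⟩
  obtain ⟨w, hws, hw⟩ := h s hs (U₀, V₀)
  refine ⟨fun t ↦ (w t).1, fun t ↦ (w t).2, congrArg Prod.fst hws,
    congrArg Prod.snd hws, fun t ht ↦ ?_⟩
  have hwt := hw t ht
  rw [hAapply] at hwt
  exact ⟨(ContinuousLinearMap.fst ℝ X X).hasFDerivAt.comp_hasDerivAt t hwt,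
    (ContinuousLinearMap.snd ℝ X X).hasFDerivAt.comp_hasDerivAt t hwt⟩

/-- A solution of the Riccati equation transports the Hamiltonian system: if `V = Y U` holds at
the initial time, then it holds as long as all three exist. -/
theorem eq_mul_of_hasDerivAt_riccati {P Q R S Y U V : ℝ → Matrix m m ℂ}
    (hP : Continuous P) (hQ : Continuous Q) {a b : ℝ}
    (hY : ∀ t ∈ Set.Ico a b,
      HasDerivAt Y (S t - Y t * P t * Y t - Q t * Y t - Y t * R t) t)
    (hU : ∀ t ∈ Set.Ico a b, HasDerivAt U (R t * U t + P t * V t) t)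
    (hV : ∀ t ∈ Set.Ico a b, HasDerivAt V (S t * U t - Q t * V t) t)
    (ha : V a = Y a * U a) : ∀ t ∈ Set.Ico a b, V t = Y t * U t := by
  intro c hc
  have hsub : ∀ t ∈ Set.Icc a c, t ∈ Set.Ico a b := fun t ht ↦ ⟨ht.1, ht.2.trans_lt hc.2⟩
  let N : ℝ → m → m → ℂ := fun t ↦ of.symm (-(Q t + Y t * P t))
  let Z : ℝ → m → m → ℂ := fun t ↦ of.symm (V t - Y t * U t)
  have hZ : ∀ t ∈ Set.Icc a c, HasDerivAt Z (mulCLM m (N t) (Z t)) t := by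
    intro t ht
    have h : S t * U t - Q t * V t - (Y t * (R t * U t + P t * V t)
        + (S t - Y t * P t * Y t - Q t * Y t - Y t * R t) * U t)
        = -(Q t + Y t * P t) * (V t - Y t * U t) := by
      noncomm_ring
    exact ((hV t (hsub t ht)).sub
      (hasDerivAt_mul (hY t (hsub t ht)) (hU t (hsub t ht)))).congr_deriv h
  have hYc : ContinuousOn Y (Set.Icc a c) := fun t ht ↦
    (hY t (hsub t ht)).continuousAt.continuousWithinAt
  have hN : ContinuousOn N (Set.Icc a c) :=
    (hQ.continuousOn.add (hYc.mul hP.continuousOn)).neg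
  obtain ⟨K, hK⟩ := isCompact_Icc.exists_bound_of_continuousOn
    ((mulCLM m).continuous.comp_continuousOn hN)
  have hZ0 : Z c = 0 := eq_zero_of_abs_deriv_le_mul_abs_self_of_eq_zero_right (K := K)
    (fun t ht ↦ (hZ t ht).continuousAt.continuousWithinAt)
    (fun t ht ↦ (hZ t (Set.Ico_subset_Icc_self ht)).hasDerivWithinAt) (sub_eq_zero.2 ha)
    (fun t ht ↦ (mulCLM m (N t)).le_of_opNorm_le (hK t (Set.Ico_subset_Icc_self ht)) (Z t))
    c (Set.right_mem_Icc.2 hc.1)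
  exact sub_eq_zero.1 hZ0

/-- A solution of the Hamiltonian system with `U` invertible yields the solution `V U⁻¹` of the
Riccati equation. -/
theorem hasDerivAt_mul_inv_riccati [DecidableEq m] {P Q R S : Matrix m m ℂ}
    {U V : ℝ → Matrix m m ℂ} {t : ℝ} (hU : HasDerivAt U (R * U t + P * V t) t)
    (hV : HasDerivAt V (S * U t - Q * V t) t) (hdet : (U t).det ≠ 0) :
    HasDerivAt (fun s ↦ V s * (U s)⁻¹)
      (S - (V t * (U t)⁻¹) * P * (V t * (U t)⁻¹) - Q * (V t * (U t)⁻¹) - (V t * (U t)⁻¹) * R) t := by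
  convert hasDerivAt_mul hV (hasDerivAt_inv hU hdet) using 1
  have h : U t * (U t)⁻¹ = 1 := mul_nonsing_inv _ (isUnit_iff_ne_zero.2 hdet)
  simp only [Matrix.mul_neg, Matrix.mul_add, Matrix.add_mul, Matrix.sub_mul, Matrix.mul_assoc, h,
    Matrix.mul_one]
  abel

/-- The trace of the coefficient matrix `R + P Y` is bounded below in terms of a lower bound `B`
for `Y + Yᴴ`. -/
theorem re_trace_add_mul_ge {P R Y B : Matrix m m ℂ} [DecidableEq m] (hP : P.PosSemidef)
    (hB : (Y + Yᴴ - B).PosSemidef) :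
    R.trace.re + (P * B).trace.re / 2 ≤ (R + P * Y).trace.re := by
  have h := hP.re_trace_mul_nonneg hB
  rw [Matrix.mul_sub, Matrix.mul_add, trace_sub, trace_add, Complex.sub_re, Complex.add_re,
    re_trace_mul_conjTranspose hP.isHermitian] at h
  rw [trace_add, Complex.add_re]
  linarith

end Riccati

theorem riccati_solution_extends {n : ℕ}
    (P Q R S : ℝ → Matrix (Fin n) (Fin n) ℂ)
    (hP : Continuous P) (hQ : Continuous Q) (hR : Continuous R) (hS : Continuous S)
    (t₀ t₁ : ℝ) (ht₀₁ : t₀ < t₁)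
    (hPpsd : ∀ t, t₀ ≤ t → (P t).PosSemidef)
    (Y : ℝ → Matrix (Fin n) (Fin n) ℂ)
    (hY : ∀ t ∈ Set.Ico t₀ t₁, HasDerivWithinAt Y
      (S t - Y t * P t * Y t - Q t * Y t - Y t * R t) (Set.Ico t₀ t₁) t)
    (B : ℝ → Matrix (Fin n) (Fin n) ℂ) (hB : Continuous B)
    (hBherm : ∀ t, (B t).IsHermitian)
    (hbound : ∀ t ∈ Set.Ico t₀ t₁, (Y t + (Y t)ᴴ - B t).PosSemidef) :
    ∃ ε > 0, ∃ Ytilde : ℝ → Matrix (Fin n) (Fin n) ℂ,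
      (∀ t ∈ Set.Ico t₀ (t₁ + ε), HasDerivWithinAt Ytilde
        (S t - Ytilde t * P t * Ytilde t - Q t * Ytilde t - Ytilde t * R t)
        (Set.Ico t₀ (t₁ + ε)) t) ∧
      (∀ t ∈ Set.Ico t₀ t₁, Ytilde t = Y t) := by
  obtain ⟨δ, hδ, hsol⟩ := exists_forall_hasDerivAt_hamiltonian hP hQ hR hS t₁
  obtain ⟨a, ha, hat₁⟩ := exists_between (max_lt ht₀₁ (sub_lt_self t₁ hδ))
  obtain ⟨ht₀a, hδa⟩ := max_lt_iff.1 ha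
  obtain ⟨U, V, hUa, hVa, hUV⟩ := hsol a ⟨hδa, by linarith⟩ 1 (Y a)
  have hY' : ∀ t ∈ Set.Ico a t₁,
      HasDerivAt Y (S t - Y t * P t * Y t - Q t * Y t - Y t * R t) t := fun t ht ↦
    (hY t ⟨ht₀a.le.trans ht.1, ht.2⟩).hasDerivAt (Ico_mem_nhds (ht₀a.trans_le ht.1) ht.2)
  have hmem : ∀ t ∈ Set.Icc a t₁, t ∈ Set.Ioo (t₁ - δ) (t₁ + δ) := fun t ht ↦
    ⟨hδa.trans_le ht.1, by linarith [ht.2]⟩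
  have hVU : ∀ t ∈ Set.Ico a t₁, V t = Y t * U t :=
    eq_mul_of_hasDerivAt_riccati hP hQ hY'
      (fun t ht ↦ (hUV t (hmem t (Set.Ico_subset_Icc_self ht))).1)
      (fun t ht ↦ (hUV t (hmem t (Set.Ico_subset_Icc_self ht))).2) (by rw [hUa, hVa, mul_one])
  have hcont : Continuous fun t ↦ (R t).trace.re + (P t * B t).trace.re / 2 :=
    (Complex.continuous_re.comp hR.matrix_trace).add
      ((Complex.continuous_re.comp (hP.mul hB).matrix_trace).div_const 2)
  obtain ⟨C, hC⟩ := (isCompact_Icc (a := a) (b := t₁)).exists_bound_of_continuousOn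
    hcont.continuousOn
  have hdet : ∀ t ∈ Set.Icc a t₁, (U t).det ≠ 0 := by
    refine det_ne_zero_of_hasDerivAt_mul (M := fun t ↦ R t + P t * Y t) (C := C)
      (fun t ht ↦ (hUV t (hmem t ht)).1.continuousAt.continuousWithinAt) (fun t ht ↦ ?_)
      (fun t ht ↦ ?_) (by simp [hUa])
    · have h := (hUV t (hmem t (Set.Ioo_subset_Icc_self ht))).1
      rwa [hVU t (Set.Ioo_subset_Ico_self ht), ← mul_assoc, ← add_mul] at h
    · exact (neg_le_of_abs_le (hC t (Set.Ioo_subset_Icc_self ht))).trans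
        (re_trace_add_mul_ge (hPpsd t (ht₀a.le.trans ht.1.le))
          (hbound t ⟨ht₀a.le.trans ht.1.le, ht.2⟩))
  have hU₁ := (hUV t₁ (hmem t₁ (Set.right_mem_Icc.2 hat₁.le))).1
  obtain ⟨η, hη, hdetη⟩ := Metric.eventually_nhds_iff.1
    ((hasDerivAt_det hU₁).continuousAt.eventually_ne (hdet t₁ (Set.right_mem_Icc.2 hat₁.le)))
  have hW : ∀ t ∈ Set.Ico a (t₁ + min δ η), HasDerivAt (fun s ↦ V s * (U s)⁻¹)
      (S t - (V t * (U t)⁻¹) * P t * (V t * (U t)⁻¹) - Q t * (V t * (U t)⁻¹)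
        - (V t * (U t)⁻¹) * R t) t := by
    intro t ht
    have htδ : t < t₁ + δ := ht.2.trans_le (by gcongr; exact min_le_left _ _)
    have htη : t < t₁ + η := ht.2.trans_le (by gcongr; exact min_le_right _ _)
    have h := hUV t ⟨hδa.trans_le ht.1, htδ⟩
    refine hasDerivAt_mul_inv_riccati h.1 h.2 ?_
    rcases le_total t t₁ with h₁ | h₁
    · exact hdet t ⟨ht.1, h₁⟩
    · exact hdetη (by rw [Real.dist_eq, abs_of_nonneg] <;> linarith)
  have hWY : ∀ t ∈ Set.Ico a t₁, V t * (U t)⁻¹ = Y t := fun t ht ↦ by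
    rw [hVU t ht, mul_assoc, mul_nonsing_inv _
      (isUnit_iff_ne_zero.2 (hdet t (Set.Ico_subset_Icc_self ht))), mul_one]
  let Z : ℝ → Matrix (Fin n) (Fin n) ℂ := fun t ↦ if t < t₁ then Y t else V t * (U t)⁻¹
  have hZY : ∀ t < t₁, Z t = Y t := fun t ht ↦ if_pos ht
  have hZW : ∀ t, a ≤ t → Z t = V t * (U t)⁻¹ := by
    intro t ht
    by_cases h : t < t₁
    · rw [hZY t h, hWY t ⟨ht, h⟩]
    · exact if_neg h
  refine ⟨min δ η, lt_min hδ hη, Z, fun t ht ↦ ?_, fun t ht ↦ hZY t ht.2⟩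
  rcases lt_or_ge t t₁ with h | h
  · rw [hZY t h]
    have hset : Set.Ico t₀ t₁ ∈ nhdsWithin t (Set.Ico t₀ (t₁ + min δ η)) := by
      filter_upwards [self_mem_nhdsWithin, nhdsWithin_le_nhds (Iio_mem_nhds h)] with s hs hs'
      exact ⟨hs.1, hs'⟩
    refine ((hY t ⟨ht.1, h⟩).mono_of_mem_nhdsWithin hset).congr_of_eventuallyEq ?_ (hZY t h)
    filter_upwards [hset] with s hs using hZY s hs.2
  · rw [hZW t (hat₁.le.trans h)]
    refine ((hW t ⟨hat₁.le.trans h, ht.2⟩).congr_of_eventuallyEq ?_).hasDerivWithinAt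
    filter_upwards [Ioi_mem_nhds (hat₁.trans_le h)] with s hs using hZW s (le_of_lt hs)
end

section
/- Let P, Q, R, S : ℝ → Matrix (Fin n) (Fin n) ℂ be continuous with P(t) Hermitian positive definite for all t, and let W : ℝ → Matrix (Fin n) (Fin n) ℂ be continuously differentiable with W(t) Hermitian positive definite and W(t)·W(t) = P(t) for all t. Define F(t) := (W(t)Q(t) − W'(t))·W(t)⁻¹ and L(t) := W(t)⁻¹·(R(t)W(t) − W'(t)). If Y is a solution of Y' + Y P(t) Y + Q(t) Y + Y R(t) − S(t) = 0 on an interval I, then Z(t) := W(t)Y(t)W(t) is differentiable on I and satisfies Z' + Z² + F(t)Z + Z L(t) − W(t)S(t)W(t) = 0 on I. -/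
open Matrix
open scoped ComplexOrder

attribute [local instance] Matrix.normedAddCommGroup Matrix.normedSpace

theorem hasDerivWithinAt_matrix_iff {m n : Type*} [Fintype m] [Fintype n]
    {A : ℝ → Matrix m n ℂ} {A' : Matrix m n ℂ} {s : Set ℝ} {t : ℝ} :
    HasDerivWithinAt A A' s t ↔
      ∀ i j, HasDerivWithinAt (fun x => A x i j) (A' i j) s t :=
  (hasDerivWithinAt_pi (φ := A) (φ' := A')).trans
    (forall_congr' fun i => hasDerivWithinAt_pi (φ := fun x => A x i) (φ' := A' i))

theorem HasDerivWithinAt.matrix_mul {l m n : Type*} [Fintype l] [Fintype m] [Fintype n]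
    {A : ℝ → Matrix l m ℂ} {B : ℝ → Matrix m n ℂ} {A' : Matrix l m ℂ} {B' : Matrix m n ℂ}
    {s : Set ℝ} {t : ℝ} (hA : HasDerivWithinAt A A' s t) (hB : HasDerivWithinAt B B' s t) :
    HasDerivWithinAt (fun x => A x * B x) (A' * B t + A t * B') s t := by
  rw [hasDerivWithinAt_matrix_iff] at hA hB ⊢
  intro i j
  simp only [Matrix.mul_apply, Matrix.add_apply, ← Finset.sum_add_distrib]
  exact HasDerivWithinAt.fun_sum fun k _ => (hA i k).mul (hB k j)

theorem riccati_sqrt_transform {n : ℕ}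
    (P Q R S : ℝ → Matrix (Fin n) (Fin n) ℂ)
    (hP : Continuous P) (hQ : Continuous Q) (hR : Continuous R) (hS : Continuous S)
    (hPpd : ∀ t, (P t).PosDef)
    (W W' : ℝ → Matrix (Fin n) (Fin n) ℂ)
    (hW : ∀ t, HasDerivAt W (W' t) t) (hW' : Continuous W')
    (hWpd : ∀ t, (W t).PosDef)
    (hWsq : ∀ t, W t * W t = P t)
    (F L : ℝ → Matrix (Fin n) (Fin n) ℂ)
    (hF : ∀ t, F t = (W t * Q t - W' t) * (W t)⁻¹)
    (hL : ∀ t, L t = (W t)⁻¹ * (R t * W t - W' t))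
    (I : Set ℝ)
    (Y : ℝ → Matrix (Fin n) (Fin n) ℂ)
    (hY : ∀ t ∈ I, HasDerivWithinAt Y
      (S t - Y t * P t * Y t - Q t * Y t - Y t * R t) I t) :
    ∀ t ∈ I, HasDerivWithinAt (fun s => W s * Y s * W s)
      (W t * S t * W t - (W t * Y t * W t) * (W t * Y t * W t)
        - F t * (W t * Y t * W t) - (W t * Y t * W t) * L t) I t := by
  intro t ht
  have hdet : IsUnit (W t).det := (Matrix.isUnit_iff_isUnit_det _).mp (hWpd t).isUnit
  have hWt := (hW t).hasDerivWithinAt (s := I)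
  convert (hWt.matrix_mul (hY t ht)).matrix_mul hWt using 1
  have hFZ : F t * (W t * Y t * W t) = (W t * Q t - W' t) * Y t * W t := by
    rw [hF, Matrix.mul_assoc (W t), Matrix.mul_assoc _ (W t)⁻¹,
      Matrix.nonsing_inv_mul_cancel_left _ _ hdet, Matrix.mul_assoc _ (Y t)]
  have hZL : (W t * Y t * W t) * L t = W t * Y t * (R t * W t - W' t) := by
    rw [hL, Matrix.mul_assoc _ (W t), Matrix.mul_nonsing_inv_cancel_left _ _ hdet]
  rw [hFZ, hZL, ← hWsq]
  noncomm_ring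
end

section
/- Let P, Q, R, S : ℝ → Matrix (Fin n) (Fin n) ℂ be continuous with P(t) Hermitian positive definite for all t, let W : ℝ → Matrix (Fin n) (Fin n) ℂ be continuously differentiable with W(t) Hermitian positive definite and W(t)·W(t) = P(t), and let ν : ℝ → ℂ be continuous. Suppose T_ν(t) := (1/2)·(W(t)⁻¹(Q(t)ᴴ − R(t))W(t) + ν(t)·I) is continuously differentiable and skew-Hermitian (T_ν(t)ᴴ = −T_ν(t)) for all t. Define D_ν(t) := T_ν'(t) + T_ν(t)² + (W(t)Q(t) − W'(t))W(t)⁻¹·T_ν(t) + T_ν(t)·W(t)⁻¹(R(t)W(t) − W'(t)) − W(t)S(t)W(t). Then for all t, D_ν(t) + D_ν(t)ᴴ = −2·T_ν(t)² + (ν(t) − conj(ν(t)))·T_ν(t) − W(t)(S(t) + S(t)ᴴ)W(t). -/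
open Matrix
open scoped ComplexOrder

attribute [local instance] Matrix.normedAddCommGroup Matrix.normedSpace

/-- The conjugate transpose commutes with differentiation. -/
theorem HasDerivAt.matrix_conjTranspose {n : ℕ} {F : ℝ → Matrix (Fin n) (Fin n) ℂ}
    {F' : Matrix (Fin n) (Fin n) ℂ} {t : ℝ} (h : HasDerivAt F F' t) :
    HasDerivAt (fun s => (F s)ᴴ) F'ᴴ t := by
  refine hasDerivAt_pi.2 fun i => hasDerivAt_pi.2 fun j => ?_
  exact (hasDerivAt_pi.1 (hasDerivAt_pi.1 h j) i).star

theorem Dnu_add_conjTranspose {n : ℕ}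
    (P Q R S : ℝ → Matrix (Fin n) (Fin n) ℂ)
    (hP : Continuous P) (hQ : Continuous Q) (hR : Continuous R) (hS : Continuous S)
    (hPpd : ∀ t, (P t).PosDef)
    (W W' : ℝ → Matrix (Fin n) (Fin n) ℂ)
    (hW : ∀ t, HasDerivAt W (W' t) t) (hW' : Continuous W')
    (hWpd : ∀ t, (W t).PosDef)
    (hWsq : ∀ t, W t * W t = P t)
    (ν : ℝ → ℂ) (hν : Continuous ν)
    (Tν Tν' : ℝ → Matrix (Fin n) (Fin n) ℂ)
    (hTνdef : ∀ t, Tν t = (1 / 2 : ℂ) •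
      ((W t)⁻¹ * ((Q t)ᴴ - R t) * W t + ν t • (1 : Matrix (Fin n) (Fin n) ℂ)))
    (hTν : ∀ t, HasDerivAt Tν (Tν' t) t) (hTν'c : Continuous Tν')
    (hskew : ∀ t, (Tν t)ᴴ = -Tν t)
    (Dν : ℝ → Matrix (Fin n) (Fin n) ℂ)
    (hDν : ∀ t, Dν t = Tν' t + Tν t * Tν t
      + (W t * Q t - W' t) * (W t)⁻¹ * Tν t
      + Tν t * ((W t)⁻¹ * (R t * W t - W' t))
      - W t * S t * W t) :
    ∀ t, Dν t + (Dν t)ᴴ =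
      -((2 : ℂ) • (Tν t * Tν t)) + (ν t - (starRingEnd ℂ) (ν t)) • Tν t
        - W t * (S t + (S t)ᴴ) * W t := by
  intro t
  have hWH : ∀ s, (W s)ᴴ = W s := fun s => (hWpd s).isHermitian
  have hW'H : (W' t)ᴴ = W' t := by
    have h := (hW t).matrix_conjTranspose
    simp only [hWH] at h
    exact h.unique (hW t)
  have hT'H : (Tν' t)ᴴ = -Tν' t := by
    have h := (hTν t).matrix_conjTranspose
    simp only [hskew] at h
    exact h.unique (hTν t).neg
  have hWinvH : ((W t)⁻¹)ᴴ = (W t)⁻¹ := by rw [conjTranspose_nonsing_inv, hWH]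
  have hK : (W t)⁻¹ * ((Q t)ᴴ - R t) * W t = (2 : ℂ) • Tν t - ν t • 1 := by
    rw [hTνdef t, smul_smul]
    norm_num
  have hKH : W t * (Q t - (R t)ᴴ) * (W t)⁻¹
      = -((2 : ℂ) • Tν t) - (starRingEnd ℂ) (ν t) • 1 := by
    have h := congrArg conjTranspose hK
    simpa [conjTranspose_mul, hWH, hWinvH, hskew, mul_assoc] using h
  have hsplit : Dν t + (Dν t)ᴴ = Tν t * Tν t + Tν t * Tν t
      + W t * (Q t - (R t)ᴴ) * (W t)⁻¹ * Tν t
      - Tν t * ((W t)⁻¹ * ((Q t)ᴴ - R t) * W t)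
      - W t * (S t + (S t)ᴴ) * W t := by
    rw [hDν t]
    simp only [conjTranspose_add, conjTranspose_sub, conjTranspose_mul, hWH, hWinvH, hW'H,
      hT'H, hskew]
    noncomm_ring
  rw [hsplit, hK, hKH]
  simp only [sub_mul, mul_sub, neg_mul, smul_mul_assoc, mul_smul_comm, one_mul, mul_one,
    sub_smul, two_smul, add_mul, mul_add]
  abel
end
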